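/- Fix D ≥ 1, a point z₀ ∈ ℝ^D, and a real k > 0. Set π = softmax(z₀) and π' = softmax(k·z₀). Let A ∈ ℝ^D satisfy Σᵢ πᵢ·Aᵢ = 0, and set C = Σ_{i : Aᵢ > 0} πᵢ·Aᵢ. Define F(z) = Σ_{i : Aᵢ > 0} πᵢ·(Aᵢ/k)·log softmax(k·z)ᵢ + Σ_{i : Aᵢ < 0} πᵢ·Aᵢ·log softmax(z)ᵢ and G(z) = Σᵢ πᵢ·Aᵢ·log softmax(z)ᵢ + C·Σᵢ π'ᵢ·log softmax(z)ᵢ, where πᵢ, Aᵢ, C and π'ᵢ are held fixed at their values determined by z₀. Then F and G have the same gradient at z₀; equivalently, the ERA-adjusted objective equals the vanilla policy-gradient objective augmented by C times a KL-divergence regularizer KL(π' ‖ softmax(z)) (whose z-independent part is constant), to first order at z₀. -/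

import Mathlib

open Real Finset

/-- The softmax map on `ℝ^D`. -/
noncomputable def softmax {D : ℕ} (z : Fin D → ℝ) (i : Fin D) : ℝ :=
  Real.exp (z i) / ∑ j, Real.exp (z j)

section SoftmaxDerivative

variable {D : ℕ}

lemma sum_exp_pos [NeZero D] (z : Fin D → ℝ) : 0 < ∑ j, Real.exp (z j) :=
  Finset.sum_pos (fun _ _ => Real.exp_pos _) Finset.univ_nonempty

lemma softmax_pos [NeZero D] (z : Fin D → ℝ) (i : Fin D) : 0 < softmax z i :=
  div_pos (Real.exp_pos _) (sum_exp_pos z)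

lemma log_softmax [NeZero D] (z : Fin D → ℝ) (i : Fin D) :
    Real.log (softmax z i) = z i - Real.log (∑ j, Real.exp (z j)) := by
  rw [softmax, Real.log_div (Real.exp_ne_zero _) (sum_exp_pos z).ne', Real.log_exp]

lemma sum_softmax [NeZero D] (z : Fin D → ℝ) : ∑ i, softmax z i = 1 := by
  simp only [softmax, ← Finset.sum_div]
  exact div_self (sum_exp_pos z).ne'

/-- The derivative of `z ↦ log softmax(z)ᵢ`, namely `v ↦ vᵢ - ∑ⱼ softmax(z)ⱼ vⱼ`. -/
noncomputable def logSoftmaxDeriv (z : Fin D → ℝ) (i : Fin D) : (Fin D → ℝ) →L[ℝ] ℝ :=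
  ContinuousLinearMap.proj i -
    ∑ j, softmax z j • (ContinuousLinearMap.proj j : (Fin D → ℝ) →L[ℝ] ℝ)

lemma logSoftmaxDeriv_apply (z : Fin D → ℝ) (i : Fin D) (v : Fin D → ℝ) :
    logSoftmaxDeriv z i v = v i - ∑ j, softmax z j * v j := by
  simp [logSoftmaxDeriv]

lemma hasFDerivAt_log_softmax [NeZero D] (z : Fin D → ℝ) (i : Fin D) :
    HasFDerivAt (fun z => Real.log (softmax z i)) (logSoftmaxDeriv z i) z := by
  have hproj (j : Fin D) : HasFDerivAt (fun z : Fin D → ℝ => z j)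
      (ContinuousLinearMap.proj j : (Fin D → ℝ) →L[ℝ] ℝ) z := hasFDerivAt_apply j z
  have hsum := HasFDerivAt.fun_sum (u := Finset.univ) fun j _ => (hproj j).exp
  have h := (hproj i).fun_sub (hsum.log (sum_exp_pos z).ne')
  simp only [log_softmax]
  refine h.congr_fderiv ?_
  rw [logSoftmaxDeriv, Finset.smul_sum]
  simp only [softmax, smul_smul, div_eq_inv_mul]

lemma hasFDerivAt_log_softmax_smul [NeZero D] (k : ℝ) (z : Fin D → ℝ) (i : Fin D) :
    HasFDerivAt (fun z => Real.log (softmax (k • z) i)) (k • logSoftmaxDeriv (k • z) i) z := by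
  have h := (hasFDerivAt_log_softmax (k • z) i).comp z ((hasFDerivAt_id z).const_smul k)
  refine h.congr_fderiv ?_
  ext v
  simp

end SoftmaxDerivative

/-- **ERA objective = policy gradient + adaptive KL regularizer, to first order (Eq. 28).**
With `π = softmax z₀`, `π' = softmax (k·z₀)`, zero-mean advantages, and
`C = Σ_{i : Aᵢ > 0} πᵢ·Aᵢ`, the ERA-adjusted objective
`F(z) = Σ_{i : Aᵢ > 0} πᵢ·(Aᵢ/k)·log softmax(k·z)ᵢ + Σ_{i : Aᵢ < 0} πᵢ·Aᵢ·log softmax(z)ᵢ`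
and the vanilla policy-gradient objective augmented by `C` times the KL-divergence
regularizer, `G(z) = Σᵢ πᵢ·Aᵢ·log softmax(z)ᵢ + C·KL(π' ‖ softmax z)` with
`KL(π' ‖ softmax z) = Σᵢ π'ᵢ·log(π'ᵢ / softmax(z)ᵢ)` (coefficients `π, A, C, π'` held
fixed at `z₀`, i.e. stop-gradient), have the same gradient at `z₀`. -/
theorem era_llm_equals_pg_plus_kl (D : ℕ) (hD : 1 ≤ D)
    (z₀ : Fin D → ℝ) (k : ℝ) (hk : 0 < k)
    (A : Fin D → ℝ) (hA : ∑ i, softmax z₀ i * A i = 0)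
    (C : ℝ) (hC : C = ∑ i ∈ Finset.univ.filter (fun i => 0 < A i), softmax z₀ i * A i)
    (F G : (Fin D → ℝ) → ℝ)
    (hF : ∀ z, F z =
      (∑ i ∈ Finset.univ.filter (fun i => 0 < A i),
        softmax z₀ i * (A i / k) * Real.log (softmax (k • z) i)) +
      ∑ i ∈ Finset.univ.filter (fun i => A i < 0),
        softmax z₀ i * A i * Real.log (softmax z i))
    (hG : ∀ z, G z =
      (∑ i, softmax z₀ i * A i * Real.log (softmax z i)) +
      C * ∑ i, softmax (k • z₀) i * Real.log (softmax (k • z₀) i / softmax z i)) :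
    DifferentiableAt ℝ F z₀ ∧ DifferentiableAt ℝ G z₀ ∧
      fderiv ℝ F z₀ = fderiv ℝ G z₀ := by
  have : NeZero D := ⟨by omega⟩
  have hF' := (HasFDerivAt.fun_sum (u := Finset.univ.filter fun i => 0 < A i) fun i _ =>
      (hasFDerivAt_log_softmax_smul k z₀ i).const_mul (softmax z₀ i * (A i / k))).fun_add
    (HasFDerivAt.fun_sum (u := Finset.univ.filter fun i => A i < 0) fun i _ =>
      (hasFDerivAt_log_softmax z₀ i).const_mul (softmax z₀ i * A i))
  have hG' := (HasFDerivAt.fun_sum (u := Finset.univ) fun i _ =>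
      (hasFDerivAt_log_softmax z₀ i).const_mul (softmax z₀ i * A i)).fun_add
    ((HasFDerivAt.fun_sum (u := Finset.univ) fun i _ =>
      ((hasFDerivAt_log_softmax z₀ i).const_sub
        (Real.log (softmax (k • z₀) i))).const_mul (softmax (k • z₀) i)).const_mul C)
  simp only [← Real.log_div (softmax_pos _ _).ne' (softmax_pos _ _).ne', ← hG] at hG'
  simp only [← hF] at hF'
  refine ⟨hF'.differentiableAt, hG'.differentiableAt, ?_⟩
  rw [hF'.fderiv, hG'.fderiv]
  have hsplit (g : Fin D → ℝ) : ∑ i, softmax z₀ i * A i * g i =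
      ∑ i ∈ Finset.univ.filter (fun i => 0 < A i), softmax z₀ i * A i * g i +
        ∑ i ∈ Finset.univ.filter (fun i => A i < 0), softmax z₀ i * A i * g i := by
    simp only [Finset.sum_filter, ← Finset.sum_add_distrib]
    refine Finset.sum_congr rfl fun i _ => ?_
    rcases lt_trichotomy (A i) 0 with h | h | h
    · simp [h, h.not_gt]
    · simp [h]
    · simp [h, h.not_gt]
  ext v
  have hk' (i : Fin D) (x : ℝ) :
      softmax z₀ i * (A i / k) * (k * x) = softmax z₀ i * A i * x := by
    field_simp
  simp only [add_apply, _root_.sum_apply, smul_apply, neg_apply, smul_eq_mul,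
    logSoftmaxDeriv_apply, hk', hsplit]
  simp only [mul_neg, mul_sub, Finset.sum_neg_distrib, Finset.sum_sub_distrib, ← Finset.sum_mul,
    sum_softmax, ← hC]
  ring
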